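/- Let α be a 2-form on ℝ⁷ with ⋆(α∧ω) = α. Then for every 1-form β on ℝ⁷ one has (α∧α)∧⋆(β∧ω) = 0; equivalently, the 4-form α∧α is orthogonal to every 4-form of the type β∧ω with β a 1-form. -/

import Mathlib

open scoped BigOperators

/-- The generalized Kronecker/Levi-Civita epsilon symbol on `Fin 7`. -/
noncomputable def eps (v : Fin 7 → Fin 7) : ℝ :=
  if h : Function.Bijective v then ((Equiv.Perm.sign (Equiv.ofBijective v h) : ℤ) : ℝ) else 0

/-- The basis monomial form `e_{I 0} ∧ ⋯ ∧ e_{I (p-1)}`, given by its components. -/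
noncomputable def mono {p : ℕ} (I : Fin p → Fin 7) : (Fin p → Fin 7) → ℝ :=
  fun v => Matrix.det (Matrix.of fun a b => if I a = v b then (1 : ℝ) else 0)

/-- A (componentwise) `p`-form: totally antisymmetric in its indices. -/
def IsForm {p : ℕ} (c : (Fin p → Fin 7) → ℝ) : Prop :=
  (∀ v : Fin p → Fin 7, ¬ Function.Injective v → c v = 0) ∧
  (∀ (v : Fin p → Fin 7) (σ : Equiv.Perm (Fin p)),
    c (v ∘ σ) = ((Equiv.Perm.sign σ : ℤ) : ℝ) * c v)

/-- Wedge product of forms, in components. -/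
noncomputable def wedge {p q : ℕ} (a : (Fin p → Fin 7) → ℝ) (b : (Fin q → Fin 7) → ℝ) :
    (Fin (p + q) → Fin 7) → ℝ := fun v =>
  (1 / ((Nat.factorial p : ℝ) * (Nat.factorial q : ℝ))) *
    ∑ σ : Equiv.Perm (Fin (p + q)),
      ((Equiv.Perm.sign σ : ℤ) : ℝ) *
        a (fun i => v (σ (Fin.castAdd q i))) * b (fun j => v (σ (Fin.natAdd p j)))

/-- The Hodge star operator (standard metric and orientation on ℝ⁷), in components. -/
noncomputable def hstar {p q : ℕ} (h : p + q = 7) (a : (Fin p → Fin 7) → ℝ) :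
    (Fin q → Fin 7) → ℝ := fun w =>
  (1 / (Nat.factorial p : ℝ)) *
    ∑ v : Fin p → Fin 7, a v * eps (fun i => Fin.append v w (Fin.cast h.symm i))

/-- The fundamental 3-form ω = e₁₂₄+e₂₃₅+e₃₄₆+e₄₅₇+e₅₆₁+e₆₇₂+e₇₁₃ (indices shifted to 0,…,6). -/
noncomputable def ω : (Fin 3 → Fin 7) → ℝ :=
  mono ![0, 1, 3] + mono ![1, 2, 4] + mono ![2, 3, 5] + mono ![3, 4, 6] +
    mono ![4, 5, 0] + mono ![5, 6, 1] + mono ![6, 0, 2]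

/-- The 4-form Φ = −e₃₅₆₇−e₄₆₇₁−e₅₇₁₂−e₆₁₂₃−e₇₂₃₄−e₁₃₄₅−e₂₄₅₆ (indices shifted to 0,…,6). -/
noncomputable def Φ : (Fin 4 → Fin 7) → ℝ :=
  -mono ![2, 4, 5, 6] - mono ![3, 5, 6, 0] - mono ![4, 6, 0, 1] - mono ![5, 0, 1, 2] -
    mono ![6, 1, 2, 3] - mono ![0, 2, 3, 4] - mono ![1, 3, 4, 5]

/-- Components ω_{ijk}. -/
noncomputable def ω3 (i j k : Fin 7) : ℝ := ω ![i, j, k]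

/-- Components ω_{ijkl} = Φ(e_i,e_j,e_k,e_l). -/
noncomputable def ω4 (i j k l : Fin 7) : ℝ := Φ ![i, j, k, l]

/-- Kronecker delta. -/
def δ (i j : Fin 7) : ℝ := if i = j then 1 else 0

/-- Components of a 2-form. -/
def c2 (a : (Fin 2 → Fin 7) → ℝ) (i j : Fin 7) : ℝ := a ![i, j]

/-- The operator α ↦ ⋆(α ∧ ω) on 2-forms. -/
noncomputable def Lω (a : (Fin 2 → Fin 7) → ℝ) : (Fin 2 → Fin 7) → ℝ :=
  hstar (p := 5) (q := 2) rfl (wedge a ω)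

open Equiv

theorem isForm_of_comp_perm {p : ℕ} {c : (Fin p → Fin 7) → ℝ}
    (h : ∀ (v : Fin p → Fin 7) (σ : Perm (Fin p)), c (v ∘ σ) = ((Perm.sign σ : ℤ) : ℝ) * c v) :
    IsForm c := by
  refine ⟨fun v hv => ?_, h⟩
  obtain ⟨i, j, hij, hne⟩ := Function.not_injective_iff.mp hv
  have hs : v ∘ swap i j = v := by
    funext k
    rcases eq_or_ne k i with rfl | hi
    · simp [hij]
    rcases eq_or_ne k j with rfl | hj
    · simp [hij]
    · simp [swap_apply_of_ne_of_ne hi hj]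
  have := h v (swap i j)
  rw [hs, Perm.sign_swap hne] at this
  push_cast at this
  linarith

theorem sign_mul_sign_self {n : ℕ} (σ : Perm (Fin n)) :
    ((Perm.sign σ : ℤ) : ℝ) * ((Perm.sign σ : ℤ) : ℝ) = 1 := by
  rcases Int.units_eq_one_or (Perm.sign σ) with h | h <;> simp [h]

theorem isForm_wedge {p q : ℕ} (a : (Fin p → Fin 7) → ℝ) (b : (Fin q → Fin 7) → ℝ) :
    IsForm (wedge a b) := by
  refine isForm_of_comp_perm fun v τ => ?_
  simp only [wedge]
  rw [mul_left_comm]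
  congr 1
  rw [Finset.mul_sum]
  refine Fintype.sum_equiv (Equiv.mulLeft τ) _ _ fun σ => ?_
  simp only [coe_mulLeft, Perm.sign_mul, Units.val_mul, Int.cast_mul, Perm.mul_apply,
    Function.comp_apply, ← mul_assoc, sign_mul_sign_self, one_mul]

theorem isForm_eps : IsForm eps := by
  refine isForm_of_comp_perm fun v σ => ?_
  have hb : Function.Bijective (v ∘ σ) ↔ Function.Bijective v := σ.bijective.of_comp_iff v
  by_cases h : Function.Bijective v
  · have hm : Equiv.ofBijective (v ∘ σ) (hb.mpr h) = Equiv.ofBijective v h * σ := by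
      ext; simp
    simp only [eps, dif_pos h, dif_pos (hb.mpr h), hm, Perm.sign_mul]
    push_cast
    ring
  · rw [eps, eps, dif_neg h, dif_neg (mt hb.mp h), mul_zero]

theorem eps_perm (σ : Perm (Fin 7)) : eps σ = ((Perm.sign σ : ℤ) : ℝ) := by
  have hm : Equiv.ofBijective σ σ.bijective = σ := by ext; simp
  simp [eps, hm]

theorem IsForm.append_left {p q : ℕ} {A : (Fin (p + q) → Fin 7) → ℝ} (hA : IsForm A)
    (w : Fin q → Fin 7) : IsForm fun u : Fin p → Fin 7 => A (Fin.append u w) := by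
  refine isForm_of_comp_perm fun u π => ?_
  have h : Fin.append (u ∘ π) w =
      Fin.append u w ∘ finSumFinEquiv.permCongr (Perm.sumCongr π (1 : Perm (Fin q))) := by
    funext i
    refine Fin.addCases (fun i => ?_) (fun i => ?_) i <;> simp [permCongr_apply]
  have hsign := Perm.sign_permCongr finSumFinEquiv (Perm.sumCongr π (1 : Perm (Fin q)))
  rw [Perm.sign_sumCongr, Perm.sign_one, mul_one] at hsign
  rw [h, hA.2, hsign]

theorem IsForm.append_right {p q : ℕ} {A : (Fin (p + q) → Fin 7) → ℝ} (hA : IsForm A)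
    (u : Fin p → Fin 7) : IsForm fun w : Fin q → Fin 7 => A (Fin.append u w) := by
  refine isForm_of_comp_perm fun w π => ?_
  have h : Fin.append u (w ∘ π) =
      Fin.append u w ∘ finSumFinEquiv.permCongr (Perm.sumCongr (1 : Perm (Fin p)) π) := by
    funext i
    refine Fin.addCases (fun i => ?_) (fun i => ?_) i <;> simp [permCongr_apply]
  have hsign := Perm.sign_permCongr finSumFinEquiv (Perm.sumCongr (1 : Perm (Fin p)) π)
  rw [Perm.sign_sumCongr, Perm.sign_one, one_mul] at hsign
  rw [h, hA.2, hsign]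

theorem sum_append {p q : ℕ} (F : (Fin (p + q) → Fin 7) → ℝ) :
    ∑ v, F v = ∑ a : Fin p → Fin 7, ∑ c : Fin q → Fin 7, F (Fin.append a c) := by
  rw [← Fintype.sum_prod_type', ← (Fin.appendEquiv p q).sum_comp]
  rfl

/-- Pairing a wedge product with a form only sees the underlying tensor product. -/
theorem sum_wedge_mul {p q : ℕ} (b : (Fin p → Fin 7) → ℝ) (c : (Fin q → Fin 7) → ℝ)
    {A : (Fin (p + q) → Fin 7) → ℝ} (hA : IsForm A) :
    ∑ v, wedge b c v * A v = (Nat.factorial (p + q) / (Nat.factorial p * Nat.factorial q) : ℝ) *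
      ∑ u, ∑ w, b u * c w * A (Fin.append u w) := by
  have key : ∀ σ : Perm (Fin (p + q)),
      ∑ v : Fin (p + q) → Fin 7, ((Perm.sign σ : ℤ) : ℝ) * b (fun i => v (σ (Fin.castAdd q i))) *
        c (fun j => v (σ (Fin.natAdd p j))) * A v =
      ∑ u, ∑ w, b u * c w * A (Fin.append u w) := by
    intro σ
    have h := sum_append (p := p) (q := q) fun v =>
      b (fun i => v (Fin.castAdd q i)) * c (fun j => v (Fin.natAdd p j)) * A v
    simp only [Fin.append_left, Fin.append_right] at h
    rw [← h]
    refine Fintype.sum_equiv (σ.symm.arrowCongr (Equiv.refl _)) _ _ fun v => ?_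
    have : (σ.symm.arrowCongr (Equiv.refl (Fin 7))) v = v ∘ σ := by
      funext i; simp [Equiv.arrowCongr]
    rw [this, hA.2]
    simp only [Function.comp_apply]
    ring
  simp only [wedge, mul_assoc, Finset.sum_mul] at key ⊢
  rw [← Finset.mul_sum, Finset.sum_comm, Finset.sum_congr rfl fun σ _ => key σ]
  simp [Fintype.card_perm]
  ring

theorem sum_mono_mul {p : ℕ} (I : Fin p → Fin 7) {A : (Fin p → Fin 7) → ℝ} (hA : IsForm A) :
    ∑ v, mono I v * A v = Nat.factorial p * A I := by
  have h : ∀ (σ : Perm (Fin p)) (v : Fin p → Fin 7),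
      (∏ i, if I (σ i) = v i then (1 : ℝ) else 0) = if I ∘ σ = v then 1 else 0 := by
    intro σ v
    rw [Finset.prod_ite_zero]
    simp [funext_iff]
  simp only [mono, Matrix.det_apply', Matrix.of_apply, h, Finset.sum_mul]
  rw [Finset.sum_comm]
  simp [hA.2, ← mul_assoc, sign_mul_sign_self, Fintype.card_perm]

/-- The Hodge star on complementary sets of basis vectors. -/
theorem hstar_perm_natAdd {b : (Fin 4 → Fin 7) → ℝ} (hb : IsForm b) (σ : Perm (Fin (4 + 3))) :
    hstar (p := 4) (q := 3) rfl b (fun j => σ (Fin.natAdd 4 j)) =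
      ((Perm.sign σ : ℤ) : ℝ) * b (fun i => σ (Fin.castAdd 3 i)) := by
  set u₀ : Fin 4 → Fin 7 := fun i => σ (Fin.castAdd 3 i)
  set w : Fin 3 → Fin 7 := fun j => σ (Fin.natAdd 4 j)
  have hu₀ : Function.Injective u₀ := σ.injective.comp (Fin.castAdd_injective 4 3)
  have happ : Fin.append u₀ w = σ := by
    funext i
    refine Fin.addCases (fun i => ?_) (fun i => ?_) i <;> simp [u₀, w]
  have hE : IsForm fun u : Fin 4 → Fin 7 => eps (Fin.append u w) :=
    IsForm.append_left (p := 4) (q := 3) isForm_eps w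
  have hzero : ∀ u ∉ Set.range (fun π : Perm (Fin 4) => u₀ ∘ π),
      b u * eps (Fin.append u w) = 0 := by
    intro u hu
    rw [mul_eq_zero]
    right
    rw [eps, dif_neg]
    intro hbij
    refine hu ?_
    have hmem : ∀ i, ∃ j, u₀ j = u i := by
      intro i
      obtain ⟨k, hk⟩ := σ.surjective (u i)
      refine Fin.addCases (motive := fun k => σ k = u i → ∃ j, u₀ j = u i)
        (fun j hj => ⟨j, hj⟩) (fun j hj => ?_) k hk
      have : Fin.append u w (Fin.natAdd 4 j) = Fin.append u w (Fin.castAdd 3 i) := by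
        simpa [w] using hj
      have := congrArg Fin.val (hbij.1 this)
      simp only [Fin.val_natAdd, Fin.val_castAdd] at this
      omega
    choose π hπ using hmem
    have hinj : Function.Injective π := by
      intro i j hij
      have : Fin.append u w (Fin.castAdd 3 i) = Fin.append u w (Fin.castAdd 3 j) := by
        simp [← hπ, hij]
      exact Fin.castAdd_injective 4 3 (hbij.1 this)
    exact ⟨Equiv.ofBijective π (Finite.injective_iff_bijective.mp hinj), funext hπ⟩
  have hinj : Function.Injective (fun π : Perm (Fin 4) => u₀ ∘ π) := by
    intro π π' h
    ext i
    exact congrArg Fin.val (hu₀ (congrFun h i))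
  change 1 / (Nat.factorial 4 : ℝ) * ∑ u, b u * eps (Fin.append u w) = _
  rw [← Fintype.sum_of_injective _ hinj (fun _ => b u₀ * eps (Fin.append u₀ w)) _ hzero]
  · rw [happ, eps_perm σ]
    simp [Fintype.card_perm]
    field_simp
  · intro π
    have := hE.2 u₀ π
    simp only at this
    rw [hb.2, this, mul_mul_mul_comm, sign_mul_sign_self, one_mul]

theorem exists_perm_castAdd {p q : ℕ} {u : Fin p → Fin (p + q)} (hu : Function.Injective u) :
    ∃ ρ : Perm (Fin (p + q)), ∀ i, ρ (Fin.castAdd q i) = u i := by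
  classical
  let e : {x // x ∈ Set.range (Fin.castAdd (m := q) (n := p))} ≃ {x // x ∈ Set.range u} :=
    (Equiv.ofInjective _ (Fin.castAdd_injective p q)).symm.trans (Equiv.ofInjective u hu)
  refine ⟨e.extendSubtype, fun i => ?_⟩
  rw [e.extendSubtype_apply_of_mem _ ⟨i, rfl⟩]
  have : (⟨Fin.castAdd q i, ⟨i, rfl⟩⟩ : Set.range (Fin.castAdd (m := q) (n := p))) =
      Equiv.ofInjective _ (Fin.castAdd_injective p q) i := rfl
  simp only [e, Equiv.trans_apply]
  erw [this, Equiv.symm_apply_apply]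
  rfl

theorem sum_perm_castAdd_eq_zero {f : (Fin 4 → Fin 7) → ℝ}
    (hf : ∀ v, ¬ Function.Injective v → f v = 0) (hsum : ∑ v, f v = 0) :
    ∑ σ : Perm (Fin (4 + 3)), f (fun i => σ (Fin.castAdd 3 i)) = 0 := by
  set S := ∑ σ : Perm (Fin (4 + 3)), f (fun i => σ (Fin.castAdd 3 i)) with hS
  have hinj : ∀ u : Fin 4 → Fin 7, Function.Injective u →
      ∑ σ : Perm (Fin (4 + 3)), f (σ ∘ u) = S := by
    intro u hu
    obtain ⟨ρ, hρ⟩ := exists_perm_castAdd (p := 4) (q := 3) hu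
    refine Fintype.sum_equiv (Equiv.mulRight ρ) _ _ fun σ => ?_
    congr 1
    funext i
    simp [hρ]
  have htotal : ∑ u : Fin 4 → Fin 7, ∑ σ : Perm (Fin (4 + 3)), f (σ ∘ u) = 0 := by
    rw [Finset.sum_comm]
    refine Finset.sum_eq_zero fun σ _ => ?_
    rw [← hsum]
    exact ((Equiv.refl (Fin 4)).arrowCongr σ).sum_comp f
  have hcount : ∑ u : Fin 4 → Fin 7, ∑ σ : Perm (Fin (4 + 3)), f (σ ∘ u) =
      ∑ u : Fin 4 → Fin 7, if Function.Injective u then S else 0 := by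
    refine Finset.sum_congr rfl fun u _ => ?_
    split_ifs with hu
    · exact hinj u hu
    · refine Finset.sum_eq_zero fun σ _ => hf _ fun h => hu h.of_comp
  rw [hcount, ← Finset.sum_filter, Finset.sum_const, smul_eq_zero] at htotal
  refine htotal.resolve_left ?_
  rw [Finset.card_eq_zero, ← ne_eq, ← Finset.nonempty_iff_ne_empty]
  exact ⟨Fin.castAdd 3, by simp [Fin.castAdd_injective 4 3]⟩

theorem wedge_hstar_eq_zero {a b : (Fin 4 → Fin 7) → ℝ} (hb : IsForm b)
    (hab : ∑ v, a v * b v = 0) : wedge a (hstar (p := 4) (q := 3) rfl b) = 0 := by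
  have hid : wedge a (hstar (p := 4) (q := 3) rfl b) (id : Fin 7 → Fin 7) = 0 := by
    have h := sum_perm_castAdd_eq_zero (f := fun v => a v * b v)
      (fun v hv => by simp [hb.1 v hv]) hab
    simp only [wedge, id_eq, hstar_perm_natAdd hb]
    rw [mul_eq_zero]
    right
    rw [← h]
    refine Finset.sum_congr rfl fun σ _ => ?_
    rw [mul_right_comm, ← mul_assoc, sign_mul_sign_self, one_mul, mul_comm]
  have hform := isForm_wedge a (hstar (p := 4) (q := 3) rfl b)
  funext v
  by_cases hv : Function.Injective v
  · have := hform.2 id (Equiv.ofBijective v (Finite.injective_iff_bijective.mp hv))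
    rw [hid, mul_zero] at this
    exact this
  · exact hform.1 v hv

/-- The seven triples whose monomials add up to `ω`. -/
def omegaTriple (t : Fin 7) : Fin 3 → Fin 7 := ![t, t + 1, t + 3]

theorem omega_eq_sum : ω = ∑ t, mono (omegaTriple t) := by
  rw [Fin.sum_univ_seven]
  rfl

theorem isForm_mono {p : ℕ} (I : Fin p → Fin 7) : IsForm (mono I) :=
  isForm_of_comp_perm fun v σ =>
    Matrix.det_permute' σ (Matrix.of fun a b => if I a = v b then (1 : ℝ) else 0)

theorem isForm_omega : IsForm ω := by
  refine isForm_of_comp_perm fun v σ => ?_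
  simp only [omega_eq_sum, Finset.sum_apply, (isForm_mono _).2, Finset.mul_sum]

/-- Integer components of a monomial 3-form. -/
def monoInt (I v : Fin 3 → Fin 7) : ℤ :=
  let m : Fin 3 → Fin 3 → ℤ := fun a b => if I a = v b then 1 else 0
  m 0 0 * m 1 1 * m 2 2 - m 0 0 * m 1 2 * m 2 1 - m 0 1 * m 1 0 * m 2 2 +
    m 0 1 * m 1 2 * m 2 0 + m 0 2 * m 1 0 * m 2 1 - m 0 2 * m 1 1 * m 2 0

theorem mono_eq_monoInt (I v : Fin 3 → Fin 7) : mono I v = monoInt I v := by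
  simp only [mono, monoInt, Matrix.det_fin_three, Matrix.of_apply]
  push_cast
  rfl

/-- The epsilon symbol as an integer product over pairs of indices. -/
def epsInt (v : Fin 7 → Fin 7) : ℤ :=
  ∏ j, ∏ i ∈ Finset.Iio j, if v i < v j then 1 else if v i = v j then 0 else -1

theorem eps_eq_epsInt (v : Fin 7 → Fin 7) : eps v = epsInt v := by
  by_cases hv : Function.Injective v
  · have hb : Function.Bijective v := Finite.injective_iff_bijective.mp hv
    rw [eps, dif_pos hb, Perm.sign_eq_prod_prod_Iio, epsInt]
    push_cast
    refine Finset.prod_congr rfl fun j _ => Finset.prod_congr rfl fun i hi => ?_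
    have hne : v i ≠ v j := fun h => (Finset.mem_Iio.mp hi).ne (hv h)
    simp only [Equiv.ofBijective_apply, hne, if_false]
    split_ifs <;> simp
  · rw [isForm_eps.1 v hv]
    obtain ⟨i, j, hij, hne⟩ := Function.not_injective_iff.mp hv
    symm
    rw [Int.cast_eq_zero, epsInt]
    wlog hlt : i < j generalizing i j
    · exact this j i hij.symm hne.symm (lt_of_le_of_ne (not_lt.mp hlt) hne.symm)
    refine Finset.prod_eq_zero (Finset.mem_univ j) ?_
    exact Finset.prod_eq_zero (Finset.mem_Iio.mpr hlt) (by simp [hij])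

theorem sum_epsInt_omegaTriple : ∀ i a b : Fin 7,
    ∑ t, epsInt ![a, b, t, t + 1, t + 3, i + 1, i + 3] =
      (if a = i + 1 ∧ b = i + 3 then 1 else 0) - (if a = i + 3 ∧ b = i + 1 then 1 else 0) -
        ∑ t, monoInt (omegaTriple t) ![i, a, b] := by
  decide +kernel

theorem sum_fin_two_arrow (F : (Fin 2 → Fin 7) → ℝ) : ∑ u, F u = ∑ a, ∑ b, F ![a, b] := by
  rw [← Fintype.sum_prod_type', ← (finTwoArrowEquiv (Fin 7)).symm.sum_comp]
  rfl

theorem Lω_apply (α : (Fin 2 → Fin 7) → ℝ) (k l : Fin 7) :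
    Lω α ![k, l] = 1 / 2 * ∑ a, ∑ b, α ![a, b] * ∑ t, eps ![a, b, t, t + 1, t + 3, k, l] := by
  have hA : IsForm fun v : Fin 5 → Fin 7 => eps (Fin.append v ![k, l]) :=
    IsForm.append_left (p := 5) (q := 2) isForm_eps ![k, l]
  have h := sum_wedge_mul (p := 2) (q := 3) α ω hA
  have hc : ∀ u : Fin 2 → Fin 7, ∑ c, ω c * eps (Fin.append (Fin.append u c) ![k, l]) =
      6 * ∑ t, eps (Fin.append (Fin.append u (omegaTriple t)) ![k, l]) := by
    intro u
    simp only [omega_eq_sum, Finset.sum_apply, Finset.sum_mul]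
    rw [Finset.sum_comm, Finset.mul_sum]
    refine Finset.sum_congr rfl fun t _ => ?_
    rw [sum_mono_mul _ (IsForm.append_right (p := 2) (q := 3) hA u)]
    norm_num [Nat.factorial]
  change 1 / (Nat.factorial 5 : ℝ) * ∑ v, wedge α ω v * eps (Fin.append v ![k, l]) = _
  rw [h]
  simp only [mul_assoc, ← Finset.mul_sum, hc]
  rw [sum_fin_two_arrow]
  have happ : ∀ a b t : Fin 7, Fin.append (Fin.append ![a, b] (omegaTriple t)) ![k, l] =
      ![a, b, t, t + 1, t + 3, k, l] := by
    intro a b t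
    funext i
    fin_cases i <;> rfl
  simp only [happ, mul_left_comm _ (6 : ℝ), ← Finset.mul_sum]
  norm_num [Nat.factorial]
  ring

/-- On `Λ²₁₄` the contraction of `α` with `ω` vanishes. -/
theorem sum_mul_omega_eq_zero {α : (Fin 2 → Fin 7) → ℝ} (hα : IsForm α) (h14 : Lω α = α)
    (i : Fin 7) : ∑ a, ∑ b, α ![a, b] * ω ![i, a, b] = 0 := by
  have h := Lω_apply α (i + 1) (i + 3)
  have hanti : α ![i + 3, i + 1] = -α ![i + 1, i + 3] := by
    have := hα.2 ![i + 1, i + 3] (swap 0 1)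
    rw [Perm.sign_swap (by decide)] at this
    have hv : ![i + 1, i + 3] ∘ swap (0 : Fin 2) 1 = ![i + 3, i + 1] := by
      funext j; fin_cases j <;> rfl
    rw [hv] at this
    simpa using this
  have he : ∀ a b : Fin 7, ∑ t, eps ![a, b, t, t + 1, t + 3, i + 1, i + 3] =
      (if a = i + 1 ∧ b = i + 3 then 1 else 0) - (if a = i + 3 ∧ b = i + 1 then 1 else 0) -
        ω ![i, a, b] := by
    intro a b
    simp only [eps_eq_epsInt, omega_eq_sum, Finset.sum_apply, mono_eq_monoInt]
    exact_mod_cast sum_epsInt_omegaTriple i a b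
  simp only [h14, he, mul_sub, Finset.sum_sub_distrib, mul_ite, mul_one, mul_zero, ite_and,
    Finset.sum_ite_eq', Finset.sum_ite_irrel, Finset.sum_const_zero, Finset.mem_univ, if_true,
    hanti] at h
  linarith

theorem wedge_one_three_apply (β : (Fin 1 → Fin 7) → ℝ) {c : (Fin 3 → Fin 7) → ℝ}
    (hc : IsForm c) (x y z w : Fin 7) :
    wedge β c ![x, y, z, w] = β ![x] * c ![y, z, w] - β ![y] * c ![x, z, w] -
      β ![z] * c ![y, x, w] - β ![w] * c ![y, z, x] := by
  have hterm : ∀ (p : Fin 4) (e : Perm (Fin 3)),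
      ((Perm.sign (Perm.decomposeFin.symm (p, e)) : ℤ) : ℝ) *
        β (fun i => ![x, y, z, w] (Perm.decomposeFin.symm (p, e) (Fin.castAdd 3 i))) *
        c (fun j => ![x, y, z, w] (Perm.decomposeFin.symm (p, e) (Fin.natAdd 1 j))) =
      (if p = 0 then 1 else -1) * β ![![x, y, z, w] p] *
        c (fun j => ![x, y, z, w] (swap 0 p j.succ)) := by
    intro p e
    have hβ : (fun i : Fin 1 => ![x, y, z, w] (Perm.decomposeFin.symm (p, e) (Fin.castAdd 3 i))) =
        ![![x, y, z, w] p] := by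
      funext i
      fin_cases i
      exact congrArg ![x, y, z, w] (Perm.decomposeFin_symm_apply_zero p e)
    have hω : (fun j : Fin 3 => ![x, y, z, w] (Perm.decomposeFin.symm (p, e) (Fin.natAdd 1 j))) =
        (fun j => ![x, y, z, w] (swap 0 p j.succ)) ∘ e := by
      funext j
      rw [show Fin.natAdd 1 j = j.succ from Fin.ext (Nat.add_comm _ _)]
      exact congrArg ![x, y, z, w] (Perm.decomposeFin_symm_apply_succ e p j)
    rw [hβ, hω, hc.2, Perm.decomposeFin.symm_sign]
    rcases Int.units_eq_one_or (Perm.sign e) with h | h <;> split_ifs <;> simp [h]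
  have hsum : ∑ σ : Perm (Fin (1 + 3)), ((Perm.sign σ : ℤ) : ℝ) *
        β (fun i => ![x, y, z, w] (σ (Fin.castAdd 3 i))) *
        c (fun j => ![x, y, z, w] (σ (Fin.natAdd 1 j))) =
      6 * ∑ p : Fin 4, (if p = 0 then 1 else -1) * β ![![x, y, z, w] p] *
        c (fun j => ![x, y, z, w] (swap 0 p j.succ)) := by
    rw [← (Perm.decomposeFin (n := 3)).symm.sum_comp, Fintype.sum_prod_type, Finset.mul_sum]
    refine Finset.sum_congr rfl fun p _ => ?_
    rw [Finset.sum_congr rfl fun e _ => hterm p e]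
    simp [Fintype.card_perm, Nat.factorial]
  have h0 : (fun j : Fin 3 => ![x, y, z, w] (swap 0 0 j.succ)) = ![y, z, w] := by
    funext j; fin_cases j <;> rfl
  have h1 : (fun j : Fin 3 => ![x, y, z, w] (swap 0 1 j.succ)) = ![x, z, w] := by
    funext j; fin_cases j <;> rfl
  have h2 : (fun j : Fin 3 => ![x, y, z, w] (swap 0 2 j.succ)) = ![y, x, w] := by
    funext j; fin_cases j <;> rfl
  have h3 : (fun j : Fin 3 => ![x, y, z, w] (swap 0 3 j.succ)) = ![y, z, x] := by
    funext j; fin_cases j <;> rfl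
  rw [wedge, hsum, Fin.sum_univ_four, h0, h1, h2, h3]
  simp [Nat.factorial]
  ring

theorem omega_swap_left (x y z : Fin 7) : ω ![y, x, z] = -ω ![x, y, z] := by
  have := isForm_omega.2 ![x, y, z] (swap 0 1)
  rw [Perm.sign_swap (by decide)] at this
  have hv : ![x, y, z] ∘ swap (0 : Fin 3) 1 = ![y, x, z] := by
    funext j; fin_cases j <;> rfl
  rw [hv] at this
  simpa using this

theorem omega_rotate (x y z : Fin 7) : ω ![y, z, x] = ω ![x, y, z] := by
  have := isForm_omega.2 ![x, y, z] (finRotate 3)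
  have hv : ![x, y, z] ∘ finRotate 3 = ![y, z, x] := by
    funext j; fin_cases j <;> rfl
  rw [hv] at this
  simpa [sign_finRotate] using this

theorem sum_wedge_self_mul_wedge_omega {α : (Fin 2 → Fin 7) → ℝ} (hα : IsForm α)
    (h14 : Lω α = α) (β : (Fin 1 → Fin 7) → ℝ) :
    ∑ v : Fin 4 → Fin 7, wedge α α v * wedge β ω v = 0 := by
  have hX := sum_mul_omega_eq_zero hα h14
  have h := sum_wedge_mul (p := 2) (q := 2) α α (A := wedge (p := 1) (q := 3) β ω)
    (isForm_wedge (p := 1) (q := 3) β ω)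
  refine h.trans ?_
  rw [mul_eq_zero]
  right
  have happ : ∀ a b c d : Fin 7, Fin.append ![a, b] ![c, d] = ![a, b, c, d] := by
    intro a b c d
    funext i; fin_cases i <;> rfl
  simp only [sum_fin_two_arrow, happ]
  have hleft : ∀ (f : Fin 7 → Fin 7 → ℝ) (g : Fin 7 → Fin 7 → Fin 7),
      ∑ a, ∑ b, ∑ c, ∑ d, f a b * (α ![c, d] * ω ![g a b, c, d]) = 0 := by
    intro f g
    simp only [← Finset.mul_sum, hX, mul_zero, Finset.sum_const_zero]
  have hright : ∀ (f : Fin 7 → Fin 7 → ℝ) (g : Fin 7 → Fin 7 → Fin 7),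
      ∑ a, ∑ b, ∑ c, ∑ d, f c d * (α ![a, b] * ω ![g c d, a, b]) = 0 := by
    intro f g
    rw [← hleft f g]
    calc
      _ = ∑ x : Fin 7 × Fin 7, ∑ y : Fin 7 × Fin 7,
          f y.1 y.2 * (α ![x.1, x.2] * ω ![g y.1 y.2, x.1, x.2]) := by
        simp only [Fintype.sum_prod_type]
      _ = _ := by
        rw [Finset.sum_comm]
        simp only [Fintype.sum_prod_type]
  have hexp : ∀ a b c d : Fin 7, α ![a, b] * α ![c, d] * wedge β ω ![a, b, c, d] =
      α ![a, b] * β ![a] * (α ![c, d] * ω ![b, c, d]) -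
      α ![a, b] * β ![b] * (α ![c, d] * ω ![a, c, d]) +
      α ![c, d] * β ![c] * (α ![a, b] * ω ![d, a, b]) -
      α ![c, d] * β ![d] * (α ![a, b] * ω ![c, a, b]) := by
    intro a b c d
    rw [wedge_one_three_apply β isForm_omega, omega_swap_left a b d, omega_rotate d a b,
      ← omega_rotate b c a]
    ring
  have h₁ := hleft (fun a b => α ![a, b] * β ![a]) fun _ b => b
  have h₂ := hleft (fun a b => α ![a, b] * β ![b]) fun a _ => a
  have h₃ := hright (fun c d => α ![c, d] * β ![c]) fun _ d => d
  have h₄ := hright (fun c d => α ![c, d] * β ![d]) fun c _ => c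
  simp only [hexp, Finset.sum_add_distrib, Finset.sum_sub_distrib, h₁, h₂, h₃, h₄, sub_zero,
    add_zero]

/-- for α ∈ Λ²₁₄ and any 1-form β, (α∧α)∧⋆(β∧ω) = 0; equivalently α∧α
is orthogonal to β∧ω. -/
theorem lambda14_wedge_square_orthogonal (α : (Fin 2 → Fin 7) → ℝ)
    (hα : IsForm α) (h14 : Lω α = α) (β : (Fin 1 → Fin 7) → ℝ) :
    wedge (wedge α α) (hstar (p := 4) (q := 3) rfl (wedge β ω)) = 0 ∧
    (∑ v : Fin 4 → Fin 7, wedge α α v * wedge β ω v) = 0 := by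
  have h := sum_wedge_self_mul_wedge_omega hα h14 β
  exact ⟨wedge_hstar_eq_zero (isForm_wedge (p := 1) (q := 3) β ω) h, h⟩
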